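/- The integers m' and n' defined in the paper's example satisfy: g := gcd(m', n') is a prime number, where m = 2⁸·5²·7·89·173·257²·263·650779²·m' and n = 2¹¹·5²·7·89·173·263·461²·6547²·n' with m, n the explicit 300+ digit integers given in Section 5.1 of the paper; equivalently, the explicit 192-digit integer 809147864157687938441948148614369785987783654943839689121548451788111145202992792430023470932052297439515068068797124401938255799311490342451172887433057574480263654457987109316488649107 is prime. -/

import Mathlib

/-!
Elliptic curve primality proving (Goldwasser–Kilian / Atkin–Morain certificates).

A step of the certificate consists of `N`, a short Weierstrass curve `y² = x³ + a x + b` and a point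
`(x, y)` on it which has order a prime `q` with `q² > 16 N`.  If `N` had a prime factor `p` with
`p² ≤ N`, the curve over `ZMod p` would have at most `2 (p + 1) < q` points, a contradiction.
The multiples are computed in Jacobian coordinates modulo `N` by kernel evaluation.
-/

namespace ECPP

open WeierstrassCurve WeierstrassCurve.Affine

/-- Evaluate `n` before passing it to `f` (call by value in the kernel). -/
def force (n : ℕ) (f : ℕ → Bool) : Bool :=
  Nat.rec (f 0) (fun k _ => f (Nat.succ k)) n

theorem force_eq (n : ℕ) (f : ℕ → Bool) : force n f = f n := by
  cases n <;> rfl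

/-- A representative of `-s` modulo `N`. -/
def neg (N s : ℕ) : ℕ := N - s % N

/-- Doubling of a point in Jacobian coordinates modulo `N`. -/
def dbl (N a X Y Z : ℕ) (f : ℕ → ℕ → ℕ → Bool) : Bool :=
  force (Y * Y % N) fun YY =>
  force (4 * X * YY % N) fun S =>
  force (Z * Z % N) fun ZZ =>
  force ((3 * (X * X) + a * (ZZ * ZZ)) % N) fun M =>
  force ((M * M + 2 * neg N S) % N) fun X3 =>
  force ((M * (S + neg N X3) + 8 * neg N (YY * YY)) % N) fun Y3 =>
  force (2 * Y * Z % N) fun Z3 => f X3 Y3 Z3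

/-- Adding the affine point `(x, y)` to a point in Jacobian coordinates modulo `N`. -/
def addp (N x y X Y Z : ℕ) (f : ℕ → ℕ → ℕ → Bool) : Bool :=
  force (Z * Z % N) fun ZZ =>
  force ((x * ZZ + neg N X) % N) fun H =>
  force ((y * (ZZ * Z) + neg N Y) % N) fun R =>
  force (H * H % N) fun HH =>
  force (HH * H % N) fun HHH =>
  force (X * HH % N) fun V =>
  force ((R * R + neg N HHH + 2 * neg N V) % N) fun X3 =>
  force ((R * (V + neg N X3) + neg N (Y * HHH)) % N) fun Y3 =>
  force (Z * H % N) fun Z3 => f X3 Y3 Z3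

/-- Double-and-add loop; at the end it tests whether the point is `-(x, y)`. -/
def go (N a x y k : ℕ) : ℕ → ℕ → ℕ → ℕ → Bool
  | 0, X, Y, Z =>
    Nat.beq (Nat.gcd Z N) 1 && (Nat.beq (X % N) (x * (Z * Z) % N) &&
      Nat.beq ((Y + y * (Z * Z * Z)) % N) 0)
  | i + 1, X, Y, Z =>
    dbl N a X Y Z fun X Y Z =>
      cond (Nat.beq (k / 2 ^ i % 2) 1) (addp N x y X Y Z (go N a x y k i)) (go N a x y k i X Y Z)

/-- The test for one step of the certificate. -/
def check (N a x y q n : ℕ) : Bool :=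
  Nat.ble (16 * N + 1) (q * q) && (Nat.beq (Nat.gcd (2 * y) N) 1 &&
    (Nat.beq ((q - 1) / 2 ^ n) 1 && go N a x y (q - 1) n x y 1))

section field

variable {F : Type*} [Field F] [DecidableEq F]

/-- The curve `y² = x³ + a x + b`. -/
def curve (a b : F) : WeierstrassCurve.Affine F := ⟨0, 0, 0, a, b⟩

/-- `(X : Y : Z)` represents `P`, or is degenerate. -/
def Rep {a b : F} (P : (curve a b).Point) (X Y Z : F) : Prop :=
  Z = 0 ∨ ∃ x y, ∃ h : (curve a b).Nonsingular x y,
    P = Point.some x y h ∧ X = x * Z ^ 2 ∧ Y = y * Z ^ 3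

theorem rep_dbl {a b : F} {P : (curve a b).Point} {X Y Z X3 Y3 Z3 S M : F} (h : Rep P X Y Z)
    (hS : S = 4 * X * (Y * Y)) (hM : M = 3 * (X * X) + a * ((Z * Z) * (Z * Z)))
    (hX : X3 = M * M + 2 * -S) (hY : Y3 = M * (S + -X3) + 8 * -((Y * Y) * (Y * Y)))
    (hZ : Z3 = 2 * Y * Z) : Rep (P + P) X3 Y3 Z3 := by
  by_cases h0 : Z3 = 0
  · exact Or.inl h0
  right
  rcases h with h | ⟨x, y, hxy, rfl, rfl, rfl⟩
  · exact absurd (by rw [hZ, h, mul_zero]) h0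
  have hy2 : 2 * y ≠ 0 := by
    intro h
    apply h0
    rw [hZ]
    linear_combination Z ^ 4 * h
  have hne : y ≠ (curve a b).negY x y := by
    intro h
    apply hy2
    simp only [negY, curve] at h
    linear_combination h
  rw [Point.add_self_of_Y_ne hne]
  refine ⟨_, _, _, rfl, ?_⟩
  obtain ⟨l, hl⟩ : ∃ l, l = (curve a b).slope x x y y := ⟨_, rfl⟩
  rw [← hl]
  rw [slope_of_Y_ne rfl hne] at hl
  have hl2 : a = l * (2 * y) - 3 * x ^ 2 := by
    have hd : y - (curve a b).negY x y = 2 * y := by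
      simp only [negY, curve]; ring
    rw [hd] at hl
    rw [hl, div_mul_cancel₀ _ hy2]
    simp only [curve]; ring
  have hM2 : M = l * Z3 := by
    rw [hM, hZ, hl2]; ring
  have hS2 : S = x * Z3 ^ 2 := by
    rw [hS, hZ]; ring
  have hX2 : X3 = (l ^ 2 - x - x) * Z3 ^ 2 := by
    rw [hX, hM2, hS2]; ring
  constructor
  · rw [hX2]; simp only [addX, curve]; ring
  · rw [hY, hX2, hM2, hS2]; simp only [addY, negAddY, negY, addX, curve]; rw [hZ]; ring

theorem rep_add {a b : F} {P : (curve a b).Point} {X Y Z X3 Y3 Z3 H R x2 y2 : F}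
    {h2 : (curve a b).Nonsingular x2 y2} (h : Rep P X Y Z)
    (hH : H = x2 * (Z * Z) + -X) (hR : R = y2 * (Z * Z * Z) + -Y)
    (hX : X3 = R * R + -(H * H * H) + 2 * -(X * (H * H)))
    (hY : Y3 = R * (X * (H * H) + -X3) + -(Y * (H * H * H)))
    (hZ : Z3 = Z * H) : Rep (P + Point.some x2 y2 h2) X3 Y3 Z3 := by
  by_cases h0 : Z3 = 0
  · exact Or.inl h0
  right
  rcases h with h | ⟨x, y, hxy, rfl, rfl, rfl⟩
  · exact absurd (by rw [hZ, h, zero_mul]) h0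
  have hne : x ≠ x2 := by
    intro h
    apply h0
    rw [hZ, hH, h]
    ring
  rw [Point.add_of_X_ne hne]
  refine ⟨_, _, _, rfl, ?_⟩
  obtain ⟨l, hl⟩ : ∃ l, l = (curve a b).slope x x2 y y2 := ⟨_, rfl⟩
  rw [← hl]
  rw [slope_of_X_ne hne] at hl
  have hl2 : y2 = y - l * (x - x2) := by
    rw [hl, div_mul_cancel₀ _ (sub_ne_zero.mpr hne)]
    ring
  have hX2 : X3 = (l ^ 2 - x - x2) * Z3 ^ 2 := by
    rw [hX, hR, hZ, hH, hl2]; ring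
  constructor
  · rw [hX2]; simp only [addX, curve]; ring
  · rw [hY, hX2, hZ, hR, hH, hl2]; simp only [addY, negAddY, negY, addX, curve]; ring

theorem card_le {a b : F} [Fintype F] (Q : (curve a b).Point) :
    addOrderOf Q ≤ 2 * (Fintype.card F + 1) := by
  classical
  by_contra hlt
  push Not at hlt
  let g : (curve a b).Point → Option F := fun P => match P with
    | .zero => none
    | .some x _ _ => Option.some x
  let s : Finset (curve a b).Point := (Finset.range (addOrderOf Q)).image (fun i => i • Q)
  have hs : s.card = addOrderOf Q := by
    rw [Finset.card_image_of_injOn, Finset.card_range]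
    intro i hi j hj hij
    exact nsmul_injOn_Iio_addOrderOf (by simpa using hi) (by simpa using hj) hij
  have hb : s.card ≤ 2 * (Finset.univ : Finset (Option F)).card := by
    apply Finset.card_le_mul_card_image_of_maps_to (f := g) (fun _ _ => Finset.mem_univ _)
    intro o _
    rcases Finset.eq_empty_or_nonempty (s.filter fun P => g P = o) with he | ⟨P, hP⟩
    · rw [he]; simp
    · have : (s.filter fun P => g P = o) ⊆ {P, -P} := by
        intro R hR
        simp only [Finset.mem_filter] at hP hR
        have hg : g R = g P := hR.2.trans hP.2.symm
        simp only [Finset.mem_insert, Finset.mem_singleton]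
        match P, R, hg with
        | .zero, .zero, _ => exact Or.inl rfl
        | .zero, .some _ _ _, hg => simp [g] at hg
        | .some _ _ _, .zero, hg => simp [g] at hg
        | .some x y h, .some x' y' h', hg =>
          have hx : x' = x := by simpa [g] using hg
          subst hx
          rcases Y_eq_of_X_eq h'.1 h.1 rfl with h1 | h1
          · subst h1; exact Or.inl rfl
          · subst h1; exact Or.inr rfl
      exact (Finset.card_le_card this).trans Finset.card_le_two
  rw [hs, Finset.card_univ, Fintype.card_option] at hb
  omega

end field

section modular

variable {N p : ℕ} [Fact p.Prime]

theorem cast_mod (hp : p ∣ N) (s : ℕ) : ((s % N : ℕ) : ZMod p) = s := by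
  rw [ZMod.natCast_eq_natCast_iff]
  exact (Nat.mod_modEq s N).of_dvd hp

theorem cast_neg (hp : p ∣ N) (hN : 0 < N) (s : ℕ) : ((neg N s : ℕ) : ZMod p) = -s := by
  rw [neg, Nat.cast_sub (Nat.mod_lt _ hN).le, cast_mod hp, (ZMod.natCast_eq_zero_iff N p).mpr hp,
    zero_sub]

theorem ne_zero_of_gcd (hp : p ∣ N) {s : ℕ} (h : Nat.gcd s N = 1) : (s : ZMod p) ≠ 0 := by
  intro h0
  have := Nat.dvd_gcd ((ZMod.natCast_eq_zero_iff s p).mp h0) hp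
  rw [h] at this
  exact (Fact.out : p.Prime).one_lt.ne' (Nat.dvd_one.mp this)

theorem go_spec (hp : p ∣ N) (hN : 0 < N) {a x y k : ℕ} {b : ZMod p}
    (h : (curve (a : ZMod p) b).Nonsingular x y) (n : ℕ) :
    ∀ X Y Z : ℕ, Rep ((k / 2 ^ n) • Point.some _ _ h) (X : ZMod p) Y Z →
      go N a x y k n X Y Z = true → k • Point.some _ _ h = -Point.some _ _ h := by
  induction n with
  | zero =>
    intro X Y Z hr hg
    simp only [go, Bool.and_eq_true, Nat.beq_eq] at hg
    obtain ⟨h1, h2, h3⟩ := hg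
    have hz := ne_zero_of_gcd hp h1
    rcases hr with hr | ⟨u, v, huv, hP, hX, hY⟩
    · exact absurd hr hz
    have e2 : (X : ZMod p) = x * (Z * Z) := by
      have := congrArg (Nat.cast : ℕ → ZMod p) h2
      rw [cast_mod hp, cast_mod hp] at this
      push_cast at this
      exact this
    have e3 : (Y : ZMod p) + y * (Z * Z * Z) = 0 := by
      have := congrArg (Nat.cast : ℕ → ZMod p) h3
      rw [cast_mod hp] at this
      push_cast at this
      exact this
    have hu : u = x := by
      apply mul_right_cancel₀ (pow_ne_zero 2 hz)
      rw [← hX, e2]; ring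
    have hv : v = -y := by
      apply mul_right_cancel₀ (pow_ne_zero 3 hz)
      rw [← hY]; linear_combination e3
    rw [pow_zero, Nat.div_one] at hP
    rw [hP, Point.neg_some]
    simp [hu, hv, negY, curve]
  | succ i ih =>
    intro X Y Z hr hg
    have hk : k / 2 ^ i = k / 2 ^ (i + 1) + k / 2 ^ (i + 1) + k / 2 ^ i % 2 := by
      rw [pow_succ, ← Nat.div_div_eq_div_mul]; omega
    simp only [go, dbl, force_eq] at hg
    have hd := rep_dbl hr rfl rfl rfl rfl rfl
    rw [← add_nsmul] at hd
    rcases Nat.mod_two_eq_zero_or_one (k / 2 ^ i) with h0 | h1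
    · rw [h0] at hg
      rw [h0, add_zero] at hk
      rw [← hk] at hd
      refine ih _ _ _ ?_ hg
      convert hd using 1 <;> (simp only [cast_mod hp, cast_neg hp hN, Nat.cast_add, Nat.cast_mul, Nat.cast_ofNat])
    · rw [h1] at hg
      simp only [addp, force_eq, Nat.beq, cond_true] at hg
      have ha := rep_add (h2 := h) hd rfl rfl rfl rfl rfl
      rw [h1] at hk
      rw [← succ_nsmul, ← hk] at ha
      refine ih _ _ _ ?_ hg
      convert ha using 1 <;> (simp only [cast_mod hp, cast_neg hp hN, Nat.cast_add, Nat.cast_mul, Nat.cast_ofNat])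

end modular

theorem step {N a x y q n : ℕ} (hN : 1 < N) (h : check N a x y q n = true) (hq : q.Prime) :
    N.Prime := by
  simp only [check, Bool.and_eq_true, Nat.beq_eq, Nat.ble_eq] at h
  obtain ⟨h1, h2, h3, h4⟩ := h
  by_contra hc
  have hpp : (Nat.minFac N).Prime := Nat.minFac_prime hN.ne'
  have hsq := Nat.minFac_sq_le_self (by omega) hc
  have hp := Nat.minFac_dvd N
  generalize Nat.minFac N = p at hpp hsq hp
  have : Fact p.Prime := ⟨hpp⟩
  have hy := ne_zero_of_gcd hp h2
  let b : ZMod p := y ^ 2 - x ^ 3 - a * x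
  have hns : (curve (a : ZMod p) b).Nonsingular x y := by
    rw [nonsingular_iff', equation_iff]
    constructor
    · simp only [curve, b]; ring
    · right
      simpa [curve] using hy
  have key := go_spec (k := q - 1) hp (by omega) hns n x y 1
    (by rw [h3, one_nsmul]; exact Or.inr ⟨_, _, hns, rfl, by simp, by simp⟩) h4
  have hz : q • Point.some _ _ hns = 0 := by
    have : q = (q - 1) + 1 := by have := hq.pos; omega
    rw [this, succ_nsmul, key, neg_add_cancel]
  have : Fact q.Prime := ⟨hq⟩
  have ho : addOrderOf (Point.some _ _ hns) = q :=
    addOrderOf_eq_prime hz (Point.some_ne_zero hns)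
  have hle := card_le (Point.some _ _ hns)
  rw [ho, ZMod.card] at hle
  have h5 := hpp.two_le
  have h6 : q ≤ 4 * p := by omega
  have h7 : q * q ≤ (4 * p) * (4 * p) := Nat.mul_le_mul h6 h6
  have h8 : (4 * p) * (4 * p) = 16 * p ^ 2 := by ring
  rw [h8] at h7
  omega

end ECPP

namespace ECPP

theorem prime_25 : Nat.Prime 4518643 := by norm_num

theorem prime_24 :
    Nat.Prime 125215408489 :=
  step (a := 0)
    (x := 90652579453)
    (y := 48307141429)
    (n := 22) (by norm_num) (by decide +kernel) prime_25

theorem prime_23 :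
    Nat.Prime 11307827791460689 :=
  step (a := 0)
    (x := 2628544933283206)
    (y := 6290452906582072)
    (n := 36) (by norm_num) (by decide +kernel) prime_24

theorem prime_22 :
    Nat.Prime 18963227205164531629 :=
  step (a := 0)
    (x := 16779087064719371721)
    (y := 8741994587263205125)
    (n := 53) (by norm_num) (by decide +kernel) prime_23

theorem prime_21 :
    Nat.Prime 550749429784142768835253066951 :=
  step (a := 0)
    (x := 110348955916074925176432197341)
    (y := 50765029898040900581956340112)
    (n := 64) (by norm_num) (by decide +kernel) prime_22

theorem prime_20 :
    Nat.Prime 182298061258551273510150391792831 :=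
  step (a := 0)
    (x := 71889008000997771724340439230284)
    (y := 131819326158729104974150578454248)
    (n := 98) (by norm_num) (by decide +kernel) prime_21

theorem prime_19 :
    Nat.Prime 2459287073360831974501005510296610004501 :=
  step (a := 0)
    (x := 127853601419758046015219609752174750871)
    (y := 2308738592096872784008274905025820626176)
    (n := 107) (by norm_num) (by decide +kernel) prime_20

theorem prime_18 :
    Nat.Prime 119864608962511986018275928913963918902867059676224505439 :=
  step (a := 0)
    (x := 25824493807589187344660287476027459225614085126228997121)
    (y := 78173306963640983125725844262012372673569501256797186880)
    (n := 130) (by norm_num) (by decide +kernel) prime_19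

theorem prime_17 :
    Nat.Prime 389205299750243881592768690496756434232955194102994747196128957 :=
  step (a := 0)
    (x := 248594516615064772882628281747492421490696884167849552277503485)
    (y := 88472513695464172912500911798704057574235280139867934382135584)
    (n := 186) (by norm_num) (by decide +kernel) prime_18

theorem prime_16 :
    Nat.Prime 334344873340438351017005966804853868350003759580862712143086259758590871 :=
  step (a := 0)
    (x := 244914627289522164919137577855912659897867263970086389528993363976769895)
    (y := 246593802893145738697449336294679122127682015931492545379067973113483205)
    (n := 207) (by norm_num) (by decide +kernel) prime_17

theorem prime_15 :
    Nat.Prime 238490538567848058848887475163669898271747639215504017729096955420221579015073 :=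
  step (a := 0)
    (x := 63752231501827373701913602677603756500838905148459533821450671999590313196179)
    (y := 78279358349748066963308539678733096171803014203494664265212421285469621726224)
    (n := 237) (by norm_num) (by decide +kernel) prime_16

theorem prime_14 :
    Nat.Prime 2548172192533412284007881534934144776355939487128672771435357364557316984231157563107 :=
  step (a := 1025341709174965583329259729079360284073185850585456556756820778413362937405003129210)
    (x := 624437541246385774023539301891337685408617198316235102436819574943372088989993033307)
    (y := 1565609120498310684499784877775947595484461150485340819680157514955697242549277255726)
    (n := 257) (by norm_num) (by decide +kernel) prime_15

theorem prime_13 :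
    Nat.Prime 44943166128207704625196414084061731795960570575198953259119304022565547178375068035213660883939242246639 :=
  step (a := 43678702035171648163481117289174658929948946020269862871808910901730546335659618986029656577858640231276)
    (x := 15956709331621242227795576643653212493518397317995777674209292292367102329674678080505018968420997062187)
    (y := 10790256722068605758338259940793203964667209806255594224861700239095133986447635682169394861210963185991)
    (n := 280) (by norm_num) (by decide +kernel) prime_14

theorem prime_12 :
    Nat.Prime 948889740554126601353052910983860085828222306453515320859085391617372807737290071894902930305056143845521533389 :=
  step (a := 24148851548194416649161347414461338977347193019439704889255261964836509437290195009218778264761343577665674174)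
    (x := 123649869028774976600126140334269541685002119656551626456613513318756321976398843778670587976166886018470576173)
    (y := 463901340244334113985064983189467593160693240611633959148906226243343668722161150410509966235178051289234969333)
    (n := 344) (by norm_num) (by decide +kernel) prime_13

theorem prime_11 :
    Nat.Prime 1457393728016120268868361975447178869295881717098530507938698224646350531240888716747970524112561750122392072234523398081 :=
  step (a := 0)
    (x := 337853118074240610750477515781006147727628726038279267312571147009184910769012304664452366956006168541017279003502049506)
    (y := 9186636298759208622491608169465373383302994818783657042508923066056148055910829706529911389682033367689084651309499981)
    (n := 368) (by norm_num) (by decide +kernel) prime_12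

theorem prime_10 :
    Nat.Prime 321534165385082971579677707367772511024840617344327853158542879735922433370004398025712524644583196708305822040390606074263280795133 :=
  step (a := 44834501369177145736989168598873475889389319439489758533853994586499247500916495114743062072866555548226562361239517887008613646525)
    (x := 314322606873214947451860660497841046751590733481891347513569212020085938543626294386260042040408067778247064318696456779947460557735)
    (y := 49068072244575530996556737068826836083095911947801512933011090602540582575960831071271393796052911126120418380465071228769865110115)
    (n := 399) (by norm_num) (by decide +kernel) prime_11

theorem prime_9 :
    Nat.Prime 9002956630782323204230975806297630308695537285641179888439200632605392409658213003948743330353160941666279595174272773899697475899877 :=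
  step (a := 8708790302587688634815664936607231285679074579619091354352623980588697863454419771715634943599031009229140120113416376976471624656620)
    (x := 1042171010001912034824411711197308893939849315649256223789003578164852433989472394920424772551762618575801075061663613754642694783127)
    (y := 4032941060381146122050438041793927255431517301569528972930800776702837563924865796478086307786148214645998384133336039274258070514850)
    (n := 436) (by norm_num) (by decide +kernel) prime_10

theorem prime_8 :
    Nat.Prime 3235896689975567300003922710154332071333202184428866722582148126574828587290057605372235964283932698815671772676888480734445235497971288801 :=
  step (a := 1569082734041080413601923118046460700732721162958406682822341486280253162633961696284201910614143133882794533193446057030212615256437316693)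
    (x := 756951680334305908571061556600397907909995601531665089987504949997086367567834803012989579016914210151515688809748242145445655623435675870)
    (y := 2500892594933555394393603119370248453246717653324403511865851891525919184293316286660636101100969354156724259778601917673357666155313909442)
    (n := 441) (by norm_num) (by decide +kernel) prime_9

theorem prime_7 :
    Nat.Prime 30713164660026668674213522528330527858560172334137472200097946702411058242997650257900426747960804239273420328123092382294683020611177094712263809271933 :=
  step (a := 10276284354499709633319852532723143953053963632128454241391602271732275475825995399440115050633974298255273165852096592128300207473658581559302915294829)
    (x := 21925987506128643106271484903287467226795262048478479828300806935802229139596124685623976610435852266655885785627243862240806656043022273305087243874747)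
    (y := 17138604564656346442914685905992774755341947647180811093138146436824387283089535007615269715624372183117061572407107793241586768626782086926311287885710)
    (n := 460) (by norm_num) (by decide +kernel) prime_8

theorem prime_6 :
    Nat.Prime 1044247598440906734923259765963237947191045859360674054803330187881975980261873617445376661646357803789381599820270459440001895225264834912504070868532761 :=
  step (a := 605075838676195415929721483074199359471888280840578811294334221493748082437744169482353900764151701189043068933795228589646019171201494477779797874090977)
    (x := 118844642849147076060814274687007774711132370862095125527526352561544198146701478623512230030038003292865244870184818248041162411883708029419611668077828)
    (y := 6733758700442750699155557418178522613896880941714445051515129561648890414657231192937448122589532314534570899288093526610280159224324056727375116740709)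
    (n := 503) (by norm_num) (by decide +kernel) prime_7

theorem prime_5 :
    Nat.Prime 3437523164889273889864891432742340248267999368870184658089219332262288742240732746900467401734124898720661507474697608676980022576200940714693525843161728657529 :=
  step (a := 2549130268362293255266353858606979340901769055206087136005344772436923811823479322262235640853494982637652003236951648979145782032087700411030615930080835974539)
    (x := 2189875273772952070144534465524254846652725068309303699439297349575033064092409884924575906381624540439342050587515033476635082177321968607093547196359483808930)
    (y := 978184475013240611200397957923328487630846032490741652400692883622213754392484755716461886030977770768566777439974706452907298137376001615385271611016983831712)
    (n := 508) (by norm_num) (by decide +kernel) prime_6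

theorem prime_4 :
    Nat.Prime 83118333870443814103148353214542888378489716627460305900154426115811779297378121452159696580528872654996438838229717528415623870584302071437439227280286466203088929801 :=
  step (a := 13341841369420594791542436417215011168502231660833029610028677657123882127555227710065973974732059759794752873471650481496952424053493925319588454316939746878828665648)
    (x := 43067049160823095015674467659077300684759178301953532587258489691306323457838909508636527749974257125518094387625749324837686917284165863454098442250094087455281774619)
    (y := 4855397277395764772877164501362835222994608094479095661300706409604856005010036950258010626225943008141338585552267691342757640770324348628614461929732007634102655883)
    (n := 529) (by norm_num) (by decide +kernel) prime_5

theorem prime_3 :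
    Nat.Prime 4155916693522190705157417660727144418924485831373015295007721305790588964868906072609186078513435791562996610826173477455419523678122115205070685752105134432271629202761 :=
  step (a := 1148624782268914201646546030797018216688003436440277633381444354479594212695571225343942091134049423547162363966656428830917584661586404843496627261674809316825771448363)
    (x := 3788599974617027706052498889170766202724743584591789249236442830593904395008193772573142188892865612689997096538948449808714091926693061926060590695482603542924009664208)
    (y := 3927820306307517903030621362266235269693745535299708472360706702886909608556895199117871907743238917699565071230849637608959545370974378396018847433401741845933804196955)
    (n := 554) (by norm_num) (by decide +kernel) prime_4

theorem prime_2 :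
    Nat.Prime 2553445087500356235537179299762686256720231188625557073436284062933407347083034317883953975175951086900908637111829298136903193569488838610627553765919851686100392636025863417 :=
  step (a := 247807741137522067643762510981145644011086688328771106401367828895240966956243337379337376710660947795627667052500638142221735473508589530350912766231021317322369558348994760)
    (x := 1436651684830264617727865560660761952610788162173602910362872656710624727577260612061114326452240134509910801645776473529961702035516490785194704141747740122788726650994135186)
    (y := 1256147870454045423623195001013383211798143261548904038084725543187780523684988132500261227766563116104090584884688070771591790563204392993448705692501794606240346806818326365)
    (n := 560) (by norm_num) (by decide +kernel) prime_3

theorem prime_1 :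
    Nat.Prime 42721689758968460176772546864329503761186188016894195395662468656938838324046247172516434334378172073127783740954964018634515630645405277546758666608604335388707613140392795947677 :=
  step (a := 20291431874529748847778448012280257352648445061476323653325363966284370977910160257559591985080591635882683611102654785441449420326093169326122835745245668024528621845862022091843)
    (x := 13801516380353634232767113103732436712271102787243379602621421790299521194970743323934045656013813213156027367774935622136446517820496653594665626833878620745358036525244820289060)
    (y := 25297348048525443907357205084898815850508108197263104714742622435059785987434311162071694385200510658455912315447014999066759563054860850483436983375239561998212393491958336471393)
    (n := 579) (by norm_num) (by decide +kernel) prime_2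

end ECPP

/-- The explicit 192-digit integer gcd(m',n') from the paper's
example is a prime number. -/
theorem stmt_12 :
    Nat.Prime 809147864157687938441948148614369785987783654943839689121548451788111145202992792430023470932052297439515068068797124401938255799311490342451172887433057574480263654457987109316488649107 := by
  exact ECPP.step (a := 101582534321234748129702998112320739680132787697239683253628841472425034059962654470435154240939509787786254029130124890770874099629522756399229078948512438125258655596720073234419597958)
    (x := 143805391166596415138810174679734465821326114030257486031143164951328931085916993832703309705222050141120347321277807870284690019721112525617159038230921439169547861553270297878830817277)
    (y := 461499655629747045195806506847208032306583237980401346586531065017760802816604166751316603116034289663125939788643044482422608004524725397853717449421425019589830478260458348663458015240)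
    (n := 593) (by norm_num) (by decide +kernel) ECPP.prime_1
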